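/- Let 0<q<1, p=q^{1/2}, and let α,β be real with α,β>−1. For every integer ν≥0, the functions X_ν^{(α,β)} and X_{ν−1}^{(α,β)} have no common zero: there is no x∈ℂ∖{0} with X_ν^{(α,β)}(x)=0 and X_{ν−1}^{(α,β)}(x)=0. -/

import Mathlib

open Finset Filter

/-- `rpw q t` is the complex number `q^t` (real power, `q > 0`). -/
noncomputable def rpw (q t : ℝ) : ℂ := ((q ^ t : ℝ) : ℂ)

/-- Finite q-shifted factorial `(a; qq)_n`. -/
noncomputable def qPoch (a qq : ℂ) (n : ℕ) : ℂ := ∏ j ∈ Finset.range n, (1 - a * qq ^ j)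

/-- Infinite q-shifted factorial `(a; qq)_∞`. -/
noncomputable def qPochInf (a qq : ℂ) : ℂ := ∏' j : ℕ, (1 - a * qq ^ j)

/-- The function `X_ν^{(α,β)}(x)` (base `p`). -/
noncomputable def Xfun (p α β : ℝ) (ν : ℤ) (x : ℂ) : ℂ :=
  (-x) ^ (-ν) *
  (qPochInf (rpw p (β + (ν : ℝ) + 2)) (p : ℂ) /
    qPochInf (rpw p (α + β + 2*(ν : ℝ) + 4)) (p : ℂ)) *
  ∑' j : ℕ,
    (qPoch (rpw p (α + (ν : ℝ) + 2)) (p : ℂ) j * qPoch (rpw p (1/2) / x) (p : ℂ) j /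
      qPoch (p : ℂ) (p : ℂ) j) *
    qPochInf (-(rpw p (α + (ν : ℝ) + 5/2 + (j : ℝ))) / x) (p : ℂ) *
    rpw p ((β + (ν : ℝ) + 2) * (j : ℝ))

section QPoch

variable {z : ℂ}

lemma qPoch_succ (a z : ℂ) (n : ℕ) : qPoch a z (n + 1) = qPoch a z n * (1 - a * z ^ n) :=
  Finset.prod_range_succ _ _

/-- Shifting the parameter `a` of a finite q-shifted factorial by `z`. -/
lemma qPoch_shift (a z : ℂ) (n : ℕ) :
    (1 - a) * qPoch (a * z) z n = qPoch a z n * (1 - a * z ^ n) := by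
  rw [← qPoch_succ, qPoch, qPoch, Finset.prod_range_succ', mul_comm]
  simp [pow_succ', mul_assoc]

lemma one_sub_ne_zero_of_norm_lt {w : ℂ} (hw : ‖w‖ < 1) : 1 - w ≠ 0 := by
  intro h
  rw [← sub_eq_zero.mp h] at hw
  simp at hw

lemma one_add_ne_zero_of_norm_lt {w : ℂ} (hw : ‖w‖ < 1) : 1 + w ≠ 0 := by
  simpa using one_sub_ne_zero_of_norm_lt (w := -w) (by simpa using hw)

lemma norm_mul_pow_lt_one {a : ℂ} (ha : ‖a‖ < 1) (hz : ‖z‖ < 1) (n : ℕ) : ‖a * z ^ n‖ < 1 := by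
  rw [norm_mul, norm_pow]
  exact (mul_le_of_le_one_right (norm_nonneg a) (pow_le_one₀ (norm_nonneg z) hz.le)).trans_lt ha

lemma qPoch_ne_zero {a : ℂ} (ha : ‖a‖ < 1) (hz : ‖z‖ < 1) (n : ℕ) : qPoch a z n ≠ 0 :=
  Finset.prod_ne_zero_iff.mpr fun j _ ↦ one_sub_ne_zero_of_norm_lt (norm_mul_pow_lt_one ha hz j)

lemma summable_norm_mul_pow (hz : ‖z‖ < 1) (a : ℂ) : Summable fun j : ℕ ↦ ‖-(a * z ^ j)‖ := by
  simpa using (summable_geometric_of_lt_one (norm_nonneg z) hz).mul_left ‖a‖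

lemma tsum_norm_mul_pow (hz : ‖z‖ < 1) (a : ℂ) :
    ∑' j : ℕ, ‖-(a * z ^ j)‖ = ‖a‖ / (1 - ‖z‖) := by
  simp [tsum_mul_left, tsum_geometric_of_lt_one (norm_nonneg z) hz, div_eq_mul_inv]

lemma multipliable_qPochInf (hz : ‖z‖ < 1) (a : ℂ) :
    Multipliable fun j : ℕ ↦ 1 - a * z ^ j := by
  simpa [sub_eq_add_neg] using multipliable_one_add_of_summable (summable_norm_mul_pow hz a)

lemma qPochInf_ne_zero {a : ℂ} (ha : ‖a‖ < 1) (hz : ‖z‖ < 1) : qPochInf a z ≠ 0 := by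
  have h := tprod_one_add_ne_zero_of_summable (f := fun j : ℕ ↦ -(a * z ^ j))
    (fun j ↦ by
      rw [← sub_eq_add_neg]
      exact one_sub_ne_zero_of_norm_lt (norm_mul_pow_lt_one ha hz j))
    (summable_norm_mul_pow hz a)
  simpa [qPochInf, sub_eq_add_neg] using h

lemma tendsto_qPoch_qPochInf (hz : ‖z‖ < 1) (a : ℂ) :
    Tendsto (qPoch a z) atTop (nhds (qPochInf a z)) :=
  (multipliable_qPochInf hz a).hasProd.tendsto_prod_nat

lemma qPochInf_step (hz : ‖z‖ < 1) (a : ℂ) :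
    qPochInf a z = (1 - a) * qPochInf (a * z) z := by
  refine tendsto_nhds_unique ((tendsto_add_atTop_iff_nat 1).mpr (tendsto_qPoch_qPochInf hz a)) ?_
  simpa only [qPoch_shift, ← qPoch_succ] using
    (tendsto_qPoch_qPochInf hz (a * z)).const_mul (1 - a)

lemma norm_qPoch_sub_one_le (hz : ‖z‖ < 1) (a : ℂ) (n : ℕ) :
    ‖qPoch a z n - 1‖ ≤ Real.exp (‖a‖ / (1 - ‖z‖)) - 1 := by
  have h := (Finset.range n).norm_prod_one_add_sub_one_le fun j : ℕ ↦ -(a * z ^ j)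
  rw [← tsum_norm_mul_pow hz]
  simp only [← sub_eq_add_neg] at h
  refine h.trans (sub_le_sub_right (Real.exp_le_exp.mpr ?_) 1)
  exact (summable_norm_mul_pow hz a).sum_le_tsum _ fun _ _ ↦ norm_nonneg _

lemma norm_qPochInf_sub_one_le (hz : ‖z‖ < 1) (a : ℂ) :
    ‖qPochInf a z - 1‖ ≤ Real.exp (‖a‖ / (1 - ‖z‖)) - 1 :=
  le_of_tendsto ((tendsto_qPoch_qPochInf hz a).sub_const 1).norm
    (Eventually.of_forall (norm_qPoch_sub_one_le hz a))

lemma exp_sub_one_tendsto_zero {a : ℕ → ℂ} (ha : Tendsto a atTop (nhds 0)) :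
    Tendsto (fun m ↦ Real.exp (‖a m‖ / (1 - ‖z‖)) - 1) atTop (nhds 0) := by
  simpa using ((Real.continuous_exp.tendsto _).comp (ha.norm.div_const (1 - ‖z‖))).sub_const 1

lemma tendsto_qPoch_one (hz : ‖z‖ < 1) {a : ℕ → ℂ} (ha : Tendsto a atTop (nhds 0)) (n : ℕ) :
    Tendsto (fun m ↦ qPoch (a m) z n) atTop (nhds 1) :=
  tendsto_iff_norm_sub_tendsto_zero.mpr <| squeeze_zero (fun _ ↦ norm_nonneg _)
    (fun m ↦ norm_qPoch_sub_one_le hz (a m) n) (exp_sub_one_tendsto_zero ha)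

lemma tendsto_qPochInf_one (hz : ‖z‖ < 1) {a : ℕ → ℂ} (ha : Tendsto a atTop (nhds 0)) :
    Tendsto (fun m ↦ qPochInf (a m) z) atTop (nhds 1) :=
  tendsto_iff_norm_sub_tendsto_zero.mpr <| squeeze_zero (fun _ ↦ norm_nonneg _)
    (fun m ↦ norm_qPochInf_sub_one_le hz (a m)) (exp_sub_one_tendsto_zero ha)

lemma norm_le_exp_of_norm_sub_one_le {w : ℂ} {s : ℝ} (h : ‖w - 1‖ ≤ Real.exp s - 1) :
    ‖w‖ ≤ Real.exp s := by
  have := norm_add_le (w - 1) 1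
  simp only [sub_add_cancel, norm_one] at this
  linarith

lemma norm_qPoch_le (hz : ‖z‖ < 1) {a : ℂ} {A : ℝ} (ha : ‖a‖ ≤ A) (n : ℕ) :
    ‖qPoch a z n‖ ≤ Real.exp (A / (1 - ‖z‖)) :=
  (norm_le_exp_of_norm_sub_one_le (norm_qPoch_sub_one_le hz a n)).trans <|
    Real.exp_le_exp.mpr (div_le_div_of_nonneg_right ha (sub_nonneg.mpr hz.le))

lemma norm_qPochInf_le (hz : ‖z‖ < 1) {a : ℂ} {A : ℝ} (ha : ‖a‖ ≤ A) :
    ‖qPochInf a z‖ ≤ Real.exp (A / (1 - ‖z‖)) :=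
  (norm_le_exp_of_norm_sub_one_le (norm_qPochInf_sub_one_le hz a)).trans <|
    Real.exp_le_exp.mpr (div_le_div_of_nonneg_right ha (sub_nonneg.mpr hz.le))

/-- The summand of `∑ (a;z)_j (u;z)_j / (z;z)_j (c z^j;z)_∞ b^j`. -/
noncomputable def qTerm (z u a c b : ℂ) (j : ℕ) : ℂ :=
  qPoch a z j * qPoch u z j / qPoch z z j * qPochInf (c * z ^ j) z * b ^ j

lemma norm_qTerm_le (hz : ‖z‖ < 1) (u : ℂ) {a c b : ℂ} {A C B : ℝ}
    (ha : ‖a‖ ≤ A) (hc : ‖c‖ ≤ C) (hb : ‖b‖ ≤ B) (j : ℕ) :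
    ‖qTerm z u a c b j‖ ≤ Real.exp (A / (1 - ‖z‖)) * Real.exp (‖u‖ / (1 - ‖z‖)) *
      Real.exp (C / (1 - ‖z‖)) * (B ^ j / ‖qPoch z z j‖) := by
  have hcj : ‖c * z ^ j‖ ≤ C := by
    rw [norm_mul, norm_pow]
    exact (mul_le_of_le_one_right (norm_nonneg c) (pow_le_one₀ (norm_nonneg z) hz.le)).trans hc
  calc ‖qTerm z u a c b j‖
      = ‖qPoch a z j‖ * ‖qPoch u z j‖ * ‖qPochInf (c * z ^ j) z‖ *
          (‖b‖ ^ j / ‖qPoch z z j‖) := by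
        simp only [qTerm, norm_mul, norm_div, norm_pow]
        ring
    _ ≤ _ := by
        gcongr
        · exact norm_qPoch_le hz ha j
        · exact norm_qPoch_le hz le_rfl j
        · exact norm_qPochInf_le hz hcj

lemma summable_pow_div_norm_qPoch (hz : ‖z‖ < 1) {B : ℝ} (hB0 : 0 < B) (hB : B < 1) :
    Summable fun j : ℕ ↦ B ^ j / ‖qPoch z z j‖ := by
  refine summable_of_ratio_test_tendsto_lt_one hB
    (Eventually.of_forall fun j ↦ (div_pos (pow_pos hB0 j)
      (norm_pos_iff.mpr (qPoch_ne_zero hz hz j))).ne') ?_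
  have hlim : Tendsto (fun j : ℕ ↦ B / ‖1 - z * z ^ j‖) atTop (nhds B) := by
    have h : Tendsto (fun j : ℕ ↦ 1 - z * z ^ j) atTop (nhds (1 - z * 0)) :=
      ((tendsto_pow_atTop_nhds_zero_of_norm_lt_one hz).const_mul z).const_sub 1
    simpa [Pi.div_def] using (tendsto_const_nhds (x := B)).div h.norm (by simp)
  refine hlim.congr fun j ↦ ?_
  have h1 := norm_ne_zero_iff.mpr (qPoch_ne_zero hz hz j)
  have h2 := norm_ne_zero_iff.mpr (one_sub_ne_zero_of_norm_lt (norm_mul_pow_lt_one hz hz j))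
  simp only [qPoch_succ, norm_div, norm_mul, Real.norm_eq_abs, abs_norm, abs_pow, abs_of_pos hB0]
  field_simp
  ring

lemma summable_qTerm (hz : ‖z‖ < 1) (u a c : ℂ) {b : ℂ} (hb0 : b ≠ 0) (hb : ‖b‖ < 1) :
    Summable (qTerm z u a c b) :=
  .of_norm_bounded ((summable_pow_div_norm_qPoch hz (norm_pos_iff.mpr hb0) hb).mul_left _)
    (norm_qTerm_le hz u le_rfl le_rfl le_rfl)

lemma tendsto_tsum_qTerm (hz : ‖z‖ < 1) (u a c : ℂ) {b : ℂ} (hb0 : b ≠ 0) (hb : ‖b‖ < 1) :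
    Tendsto (fun m : ℕ ↦ ∑' j, qTerm z u (a * z ^ m) (c * z ^ m) (b * z ^ m) j)
      atTop (nhds 1) := by
  have hle (w : ℂ) (m : ℕ) : ‖w * z ^ m‖ ≤ ‖w‖ := by
    rw [norm_mul, norm_pow]
    exact mul_le_of_le_one_right (norm_nonneg w) (pow_le_one₀ (norm_nonneg z) hz.le)
  have hlim (w : ℂ) : Tendsto (fun m : ℕ ↦ w * z ^ m) atTop (nhds 0) := by
    simpa using (tendsto_pow_atTop_nhds_zero_of_norm_lt_one hz).const_mul w
  rw [← tsum_ite_eq (0 : ℕ) fun _ ↦ (1 : ℂ)]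
  refine tendsto_tsum_of_dominated_convergence
    ((summable_pow_div_norm_qPoch hz (norm_pos_iff.mpr hb0) hb).mul_left _) (fun j ↦ ?_)
    (Eventually.of_forall fun m j ↦ norm_qTerm_le hz u (hle a m) (hle c m) (hle b m) j)
  have hc : Tendsto (fun m : ℕ ↦ c * z ^ m * z ^ j) atTop (nhds 0) := by
    simpa using (hlim c).mul_const (z ^ j)
  have h := ((((tendsto_qPoch_one hz (hlim a) j).mul_const (qPoch u z j)).div_const
    (qPoch z z j)).mul (tendsto_qPochInf_one hz hc)).mul ((hlim b).pow j)
  rcases eq_or_ne j 0 with rfl | hj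
  · simpa [qTerm, qPoch] using h
  · simpa [qTerm, hj] using h

/-- Three-term contiguous relation under the shift `(a, b) ↦ (a z, b z)`. -/
lemma exists_tsum_qTerm_recurrence (hz0 : z ≠ 0) (hz : ‖z‖ < 1) {u a b : ℂ} (hu : u ≠ 0)
    (ha0 : a ≠ 0) (ha : ‖a‖ < 1) (hb0 : b ≠ 0) (hb : ‖b‖ < 1) :
    ∃ K L : ℂ, L ≠ 0 ∧
      ∑' j, qTerm z u a (-(a * u)) b j
        - K * ∑' j, qTerm z u (a * z) (-(a * z * u)) (b * z) j
        + L * ∑' j, qTerm z u (a * z ^ 2) (-(a * z ^ 2 * u)) (b * z ^ 2) j = 0 := by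
  have hab : ‖a * b‖ < 1 := by
    rw [norm_mul]
    exact mul_lt_one_of_nonneg_of_lt_one_left (norm_nonneg a) ha hb.le
  have haz : ‖a * z‖ < 1 := by simpa using norm_mul_pow_lt_one ha hz 1
  have hbz : ‖b * z‖ < 1 := by simpa using norm_mul_pow_lt_one hb hz 1
  have hbz2 := norm_mul_pow_lt_one hb hz 2
  have n1 := one_sub_ne_zero_of_norm_lt ha
  have n2 := one_sub_ne_zero_of_norm_lt hb
  have n3 := one_sub_ne_zero_of_norm_lt hab
  have n4 := one_sub_ne_zero_of_norm_lt (norm_mul_pow_lt_one hab hz 2)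
  have n5 := one_add_ne_zero_of_norm_lt haz
  have n6 := one_add_ne_zero_of_norm_lt hbz
  have n7 := one_sub_ne_zero_of_norm_lt haz
  obtain ⟨L, hL⟩ : ∃ L, L = -(u ^ 2 * (1 - a * b) * a * b * z * (1 + a * z) * (1 + b * z)) /
    ((1 - a) * (1 - b) * (1 - a * b * z ^ 2)) := ⟨_, rfl⟩
  obtain ⟨r₀, hr₀⟩ : ∃ r, r = -1 / (1 - b) := ⟨_, rfl⟩
  obtain ⟨r₂, hr₂⟩ : ∃ r, r = L * a / (u * (1 + b * z)) := ⟨_, rfl⟩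
  obtain ⟨r₁, hr₁⟩ : ∃ r, r = a * (a * (1 + u) / (1 - a) - r₀) - r₂ / a := ⟨_, rfl⟩
  obtain ⟨K, hK⟩ : ∃ K, K = a * u * (1 + z) - b * z * r₁ + b * (a + u) * r₀ + r₁
    - (1 - a * u * z) * r₀ := ⟨_, rfl⟩
  have hL0 : L ≠ 0 := by
    rw [hL]
    exact div_ne_zero (neg_ne_zero.mpr (by simp [*])) (by simp [*])
  have m6 : 1 + z * b ≠ 0 := by rwa [mul_comm]
  have m4 : 1 - a * z ^ 2 * b ≠ 0 := by rwa [mul_right_comm]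
  have key (P : ℂ) : (1 + a * u * P) * (1 + a * u * P * z)
      - K * (1 - a * P) * (1 + a * u * P * z) * P + L * (1 - a * P) * (1 - a * P * z) * P ^ 2
      = (1 - a * P) * (1 - u * P) * b * (r₀ + r₁ * (P * z) + r₂ * (P * z) ^ 2)
        - (1 - P) * (1 + a * u * P * z) * (r₀ + r₁ * P + r₂ * P ^ 2) := by
    have e2 : -K * (a * u * z - a) + L + a ^ 2 * u ^ 2 * z
        = b * (r₂ * z ^ 2 - (a + u) * r₁ * z + a * u * r₀) - r₂ + (1 - a * u * z) * r₁
          + a * u * z * r₀ := by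
      subst hK hr₁ hr₂ hr₀ hL
      field_simp
      ring
    have e3 : K * a * (a * u * z) - L * a * (1 + z)
        = b * (-(a + u) * r₂ * z ^ 2 + a * u * r₁ * z) + (1 - a * u * z) * r₂
          + a * u * z * r₁ := by
      subst hK hr₁ hr₂ hr₀ hL
      field_simp
      ring
    have e0 : 1 = b * r₀ - r₀ := by
      subst hr₀
      field_simp
      ring
    have e4 : L * a ^ 2 * z = b * a * u * r₂ * z ^ 2 + a * u * z * r₂ := by
      subst hr₂
      field_simp
      ring
    linear_combination e0 + P ^ 2 * e2 + P ^ 3 * e3 + P ^ 4 * e4 - P * hK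
  let G (j : ℕ) : ℂ := (1 - z ^ j) * (r₀ + r₁ * z ^ j + r₂ * (z ^ j) ^ 2) *
    qTerm z u a (-(a * u * z)) b j
  have hG : Summable G := by
    refine .of_norm_bounded (g := fun j ↦ (1 + 1) * (‖r₀‖ + ‖r₁‖ * 1 + ‖r₂‖ * 1 ^ 2) *
      ‖qTerm z u a (-(a * u * z)) b j‖) ((summable_qTerm hz u a _ hb0 hb).norm.mul_left _)
      fun j ↦ ?_
    have hzj : ‖z ^ j‖ ≤ 1 := by
      rw [norm_pow]
      exact pow_le_one₀ (norm_nonneg z) hz.le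
    have h1 : ‖1 - z ^ j‖ ≤ 1 + 1 := (norm_sub_le _ _).trans (by simpa using hzj)
    have h2 : ‖r₀ + r₁ * z ^ j + r₂ * (z ^ j) ^ 2‖ ≤ ‖r₀‖ + ‖r₁‖ * 1 + ‖r₂‖ * 1 ^ 2 := by
      refine norm_add₃_le.trans ?_
      rw [norm_mul, norm_mul, norm_pow (z ^ j)]
      gcongr
    simp only [G, norm_mul]
    gcongr
  have hG0 : G 0 = 0 := by simp [G]
  have hGtsum : ∑' j, (G (j + 1) - G j) = 0 := by
    rw [((summable_nat_add_iff 1).mpr hG).tsum_sub hG, hG.tsum_eq_zero_add, hG0]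
    ring
  have hterm (j : ℕ) : qTerm z u a (-(a * u)) b j
      - K * (1 - a) * qTerm z u (a * z) (-(a * z * u)) (b * z) j
      + L * ((1 - a) * (1 - a * z)) * qTerm z u (a * z ^ 2) (-(a * z ^ 2 * u)) (b * z ^ 2) j
      = G (j + 1) - G j := by
    have hQ₀ := qPochInf_step hz (-(a * u) * z ^ j)
    have hQ₁ := qPochInf_step hz (-(a * u) * z ^ j * z)
    have hA₁ := qPoch_shift a z j
    have hA₂ := qPoch_shift (a * z) z j
    have c₁ : -(a * z * u) * z ^ j = -(a * u) * z ^ j * z := by ring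
    have c₂ : -(a * z ^ 2 * u) * z ^ j = -(a * u) * z ^ j * z * z := by ring
    have c₃ : -(a * u * z) * z ^ j = -(a * u) * z ^ j * z := by ring
    have c₄ : -(a * u * z) * z ^ (j + 1) = -(a * u) * z ^ j * z * z := by ring
    have c₅ : a * z ^ 2 = a * z * z := by ring
    have hd := qPoch_ne_zero hz hz j
    have hd' := one_sub_ne_zero_of_norm_lt (norm_mul_pow_lt_one hz hz j)
    have hb₁ : (b * z) ^ j = b ^ j * z ^ j := mul_pow ..
    have hb₂ : (b * z ^ 2) ^ j = b ^ j * (z ^ j) ^ 2 := by ring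
    simp only [G, qTerm, c₁, c₂, c₃, c₄, qPoch_succ, hb₁, hb₂, pow_succ b j]
    rw [c₅, hQ₀, hQ₁, pow_succ z j]
    have hk := key (z ^ j)
    generalize qPochInf (-(a * u) * z ^ j * z * z) z = Q at *
    generalize z ^ j = P at *
    generalize b ^ j = B at *
    generalize qPoch (a * z * z) z j = A₂ at *
    generalize qPoch (a * z) z j = A₁ at *
    generalize qPoch a z j = A at *
    generalize qPoch u z j = U at *
    generalize qPoch z z j = D at *
    rw [mul_comm z P] at hd' ⊢
    have hA₂' : (1 - a) * (1 - a * z) * A₂ = A * (1 - a * P) * (1 - a * z * P) := by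
      rw [mul_assoc, hA₂, ← mul_assoc, hA₁]
    have hc : (1 - P * z) * (A * (1 - a * P) * (U * (1 - u * P)) / (D * (1 - P * z)))
        = A * (1 - a * P) * (U * (1 - u * P)) / D := by
      field_simp
    linear_combination A * U / D * Q * B * hk
      - K * (U / D * (1 - -(a * u) * P * z) * Q * B * P) * hA₁
      + L * (U / D * Q * B * P ^ 2) * hA₂'
      - (r₀ + r₁ * (P * z) + r₂ * (P * z) ^ 2) * Q * B * b * hc
  have s₀ := summable_qTerm hz u a (-(a * u)) hb0 hb
  have s₁ := summable_qTerm hz u (a * z) (-(a * z * u)) (mul_ne_zero hb0 hz0) hbz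
  have s₂ := summable_qTerm hz u (a * z ^ 2) (-(a * z ^ 2 * u))
    (mul_ne_zero hb0 (pow_ne_zero 2 hz0)) hbz2
  refine ⟨K * (1 - a), L * ((1 - a) * (1 - a * z)), by simp [*], ?_⟩
  rw [← tsum_mul_left, ← tsum_mul_left, ← s₀.tsum_sub (s₁.mul_left _),
    ← (s₀.sub (s₁.mul_left _)).tsum_add (s₂.mul_left _), ← hGtsum]
  exact tsum_congr hterm

end QPoch

lemma rpw_norm_lt_one {p : ℝ} (hp0 : 0 < p) (hp1 : p < 1) {t : ℝ} (ht : 0 < t) :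
    ‖rpw p t‖ < 1 := by
  rw [rpw, Complex.norm_real, Real.norm_eq_abs, abs_of_pos (Real.rpow_pos_of_pos hp0 t)]
  exact Real.rpow_lt_one hp0.le hp1 ht

lemma rpw_ne_zero {p : ℝ} (hp0 : 0 < p) (t : ℝ) : rpw p t ≠ 0 :=
  Complex.ofReal_ne_zero.mpr (Real.rpow_pos_of_pos hp0 t).ne'

lemma rpw_add {p : ℝ} (hp0 : 0 < p) (s t : ℝ) : rpw p (s + t) = rpw p s * rpw p t := by
  simp [rpw, Real.rpow_add hp0]

lemma rpw_natCast (p : ℝ) (n : ℕ) : rpw p n = (p : ℂ) ^ n := by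
  simp [rpw]

lemma rpw_mul_natCast {p : ℝ} (hp0 : 0 < p) (t : ℝ) (n : ℕ) : rpw p (t * n) = rpw p t ^ n := by
  simp [rpw, Real.rpow_mul hp0.le]

lemma tsum_qTerm_eq_zero_of_Xfun_eq_zero {p α β : ℝ} (hp0 : 0 < p) (hp1 : p < 1)
    (hα : -1 < α) (hβ : -1 < β) {ν : ℤ} (hν : -1 ≤ ν) {x : ℂ} (hx : x ≠ 0)
    (h : Xfun p α β ν x = 0) :
    ∑' j, qTerm p (rpw p (1 / 2) / x) (rpw p (α + ν + 2))
      (-(rpw p (α + ν + 2) * (rpw p (1 / 2) / x))) (rpw p (β + ν + 2)) j = 0 := by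
  have hν' : (-1 : ℝ) ≤ ν := by exact_mod_cast hν
  have hz : ‖(p : ℂ)‖ < 1 := by simpa [abs_of_pos hp0] using hp1
  have h1 := qPochInf_ne_zero (rpw_norm_lt_one hp0 hp1 (t := β + ν + 2) (by linarith)) hz
  have h2 := qPochInf_ne_zero
    (rpw_norm_lt_one hp0 hp1 (t := α + β + 2 * ν + 4) (by linarith)) hz
  rw [Xfun, mul_eq_zero_iff_left
    (mul_ne_zero (zpow_ne_zero _ (neg_ne_zero.mpr hx)) (div_ne_zero h1 h2))] at h
  rw [← h]
  refine tsum_congr fun j ↦ ?_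
  have e : α + (ν : ℝ) + 5 / 2 + (j : ℝ) = (α + ν + 2) + 1 / 2 + j := by ring
  rw [qTerm, e, rpw_add hp0 _ j, rpw_add hp0 _ (1 / 2), rpw_natCast, rpw_mul_natCast hp0]
  congr 3
  ring

theorem statement8 (q α β : ℝ) (hq0 : 0 < q) (hq1 : q < 1)
    (hα : -1 < α) (hβ : -1 < β)
    (p : ℝ) (hp : p = q ^ ((1 : ℝ)/2)) (ν : ℕ) :
    ¬ ∃ x : ℂ, x ≠ 0 ∧ Xfun p α β (ν : ℤ) x = 0 ∧ Xfun p α β ((ν : ℤ) - 1) x = 0 := by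
  rintro ⟨x, hx, h1, h0⟩
  have hp0 : 0 < p := hp ▸ Real.rpow_pos_of_pos hq0 _
  have hp1 : p < 1 := hp ▸ Real.rpow_lt_one hq0.le hq1 (by norm_num)
  have hz0 : (p : ℂ) ≠ 0 := Complex.ofReal_ne_zero.mpr hp0.ne'
  have hz : ‖(p : ℂ)‖ < 1 := by simpa [abs_of_pos hp0] using hp1
  have hν : (0 : ℝ) ≤ ν := ν.cast_nonneg
  have hs (t : ℝ) : rpw p (t + ν + 2) = rpw p (t + ν + 1) * p := by
    have e : t + (ν : ℝ) + 2 = t + ν + 1 + (1 : ℕ) := by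
      push_cast
      ring
    rw [e, rpw_add hp0, rpw_natCast, pow_one]
  replace h0 := tsum_qTerm_eq_zero_of_Xfun_eq_zero hp0 hp1 hα hβ (by lia) hx h0
  replace h1 := tsum_qTerm_eq_zero_of_Xfun_eq_zero hp0 hp1 hα hβ (by lia) hx h1
  have e (t : ℝ) : t + (((ν : ℤ) - 1 : ℤ) : ℝ) + 2 = t + ν + 1 := by
    push_cast
    ring
  simp only [e] at h0
  simp only [Int.cast_natCast, hs] at h1
  have ha0 := rpw_ne_zero hp0 (α + ν + 1)
  have hb0 := rpw_ne_zero hp0 (β + ν + 1)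
  have ha := rpw_norm_lt_one hp0 hp1 (t := α + ν + 1) (by linarith)
  have hb := rpw_norm_lt_one hp0 hp1 (t := β + ν + 1) (by linarith)
  have hu : rpw p (1 / 2) / x ≠ 0 := div_ne_zero (rpw_ne_zero hp0 _) hx
  generalize rpw p (α + ν + 1) = a at *
  generalize rpw p (β + ν + 1) = b at *
  generalize rpw p (1 / 2) / x = u at *
  generalize (p : ℂ) = z at *
  have hzero (m : ℕ) :
      ∑' j, qTerm z u (a * z ^ m) (-(a * z ^ m * u)) (b * z ^ m) j = 0 ∧
      ∑' j, qTerm z u (a * z ^ (m + 1)) (-(a * z ^ (m + 1) * u)) (b * z ^ (m + 1)) j = 0 := by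
    induction m with
    | zero => simpa using ⟨h0, h1⟩
    | succ m ih =>
      refine ⟨ih.2, ?_⟩
      obtain ⟨K, L, hL, hrec⟩ := exists_tsum_qTerm_recurrence hz0 hz hu
        (mul_ne_zero ha0 (pow_ne_zero m hz0)) (norm_mul_pow_lt_one ha hz m)
        (mul_ne_zero hb0 (pow_ne_zero m hz0)) (norm_mul_pow_lt_one hb hz m)
      simp only [mul_assoc _ (z ^ m), ← pow_succ, ← pow_add] at hrec
      simp only [← mul_assoc] at hrec
      rw [ih.1, ih.2, mul_zero, sub_zero, zero_add] at hrec
      exact (mul_eq_zero.mp hrec).resolve_left hL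
  have hlim := tendsto_tsum_qTerm hz u a (-(a * u)) hb0 hb
  have hc (m : ℕ) : -(a * u) * z ^ m = -(a * z ^ m * u) := by ring
  simp only [hc, (hzero _).1] at hlim
  exact zero_ne_one (tendsto_nhds_unique tendsto_const_nhds hlim)
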